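/- arXiv:2302.09638 — 7 statements merged into one kernel-verified Lean document; each statement's English description precedes it below -/
import Mathlib

section
/- Let p, q ≥ 1 and n = p + q. There exist X, Y ∈ s such that trace(H_Θ * (X * Y − Y * X)) ≠ 0. (Since the Cartan–Killing form of sl(n,ℂ) is a nonzero multiple of the trace form, this shows that the submanifold S is NOT Lagrangian for the Kirillov–Kostant–Souriau form Ω_ξ([X,ξ],[Y,ξ]) = K(ξ,[X,Y]) at ξ = H_Θ.) -/
open Matrix

theorem Matrix.trace_fromBlocks_eq {m n R : Type*} [Fintype m] [Fintype n] [AddCommMonoid R]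
    (A : Matrix m m R) (B : Matrix m n R) (C : Matrix n m R) (D : Matrix n n R) :
    (fromBlocks A B C D).trace = A.trace + D.trace := by
  simp [trace, Fintype.sum_sum_type]

/-- There exist `X, Y ∈ s` with `trace (H_Θ * (XY − YX)) ≠ 0`: the submanifold `S` is
not Lagrangian for the Kirillov–Kostant–Souriau form at `H_Θ`. -/
theorem stmt8 (p q : ℕ) (hp : 0 < p) (hq : 0 < q)
    (HΘ : Matrix (Fin p ⊕ Fin q) (Fin p ⊕ Fin q) ℂ)
    (hHΘ : HΘ = (Complex.I * (Real.pi : ℂ) / ((p + q : ℕ) : ℂ)) •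
      fromBlocks ((q : ℂ) • 1) 0 0 (-((p : ℂ) • 1))) :
    ∃ X ∈ {M : Matrix (Fin p ⊕ Fin q) (Fin p ⊕ Fin q) ℂ |
        ∃ B : Matrix (Fin p) (Fin q) ℂ, M = fromBlocks 0 B Bᴴ 0},
      ∃ Y ∈ {M : Matrix (Fin p ⊕ Fin q) (Fin p ⊕ Fin q) ℂ |
        ∃ B : Matrix (Fin p) (Fin q) ℂ, M = fromBlocks 0 B Bᴴ 0},
      (HΘ * (X * Y - Y * X)).trace ≠ 0 := by
  have hn : ((p : ℂ) + q) ≠ 0 := by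
    exact_mod_cast (show p + q ≠ 0 by omega)
  let B : Matrix (Fin p) (Fin q) ℂ := single ⟨0, hp⟩ ⟨0, hq⟩ 1
  let C : Matrix (Fin p) (Fin q) ℂ := single ⟨0, hp⟩ ⟨0, hq⟩ Complex.I
  refine ⟨fromBlocks 0 B Bᴴ 0, ⟨B, rfl⟩, fromBlocks 0 C Cᴴ 0, ⟨C, rfl⟩, ?_⟩
  have htrace : (HΘ * (fromBlocks 0 B Bᴴ 0 * fromBlocks 0 C Cᴴ 0 -
      fromBlocks 0 C Cᴴ 0 * fromBlocks 0 B Bᴴ 0)).trace = 2 * (Real.pi : ℂ) := by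
    simp only [hHΘ, B, C, fromBlocks_multiply, sub_eq_add_neg, fromBlocks_neg, fromBlocks_add,
      smul_mul, trace_smul, trace_fromBlocks_eq, conjTranspose_single, single_mul_single_same,
      zero_mul, Matrix.zero_mul, Matrix.mul_zero, zero_add, add_zero, Matrix.one_mul,
      Matrix.neg_mul, trace_neg, trace_add, trace_single_eq_same, smul_eq_mul]
    simp only [star_one, Complex.star_def, Complex.conj_I]
    push_cast
    field_simp
    linear_combination (-2 * ((p : ℂ) + q)) * Complex.I_sq
  rw [htrace]
  exact mul_ne_zero two_ne_zero (Complex.ofReal_ne_zero.mpr Real.pi_ne_zero)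
end

section
/- Let l ≥ 1. A block matrix fromBlocks a b c d (with a,b,c,d ∈ Matrix l l ℂ) belongs to Sp(l,ℂ) and commutes with g_Θ = diag(iI_l, −iI_l) if and only if b = 0, c = 0, a is invertible and d = (aᵀ)⁻¹. Hence the centralizer of g_Θ in Sp(l,ℂ) equals {Matrix.fromBlocks a 0 0 ((aᵀ)⁻¹) : a ∈ GL(l,ℂ)}, and it coincides with the centralizer of H_Θ = (π/2)•g_Θ in Sp(l,ℂ). -/
open Matrix

theorem I_smul_eq_neg_I_smul_iff {m n : Type*} (x : Matrix m n ℂ) :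
    Complex.I • x = -(Complex.I • x) ↔ x = 0 := by
  simp [← Matrix.ext_iff, self_eq_neg]

/-- Block matrices commuting with `diag(i·I, −i·I)` are exactly the block diagonal ones. -/
theorem fromBlocks_mul_diag_I_comm_iff {m n : Type*} [Fintype m] [Fintype n] [DecidableEq m]
    [DecidableEq n] (a : Matrix m m ℂ) (b : Matrix m n ℂ) (c : Matrix n m ℂ) (d : Matrix n n ℂ) :
    fromBlocks a b c d * fromBlocks (Complex.I • 1) 0 0 ((-Complex.I) • 1) =
        fromBlocks (Complex.I • 1) 0 0 ((-Complex.I) • 1) * fromBlocks a b c d ↔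
      b = 0 ∧ c = 0 := by
  simp [fromBlocks_multiply, fromBlocks_inj, eq_comm (a := -(Complex.I • b)),
    I_smul_eq_neg_I_smul_iff]

/-- A block diagonal matrix is symplectic iff its blocks are inverse transposes of each other. -/
theorem fromBlocks_diagonal_symplectic_iff {n R : Type*} [Fintype n] [DecidableEq n]
    [CommRing R] (a d : Matrix n n R) :
    (fromBlocks a 0 0 d)ᵀ * fromBlocks 0 1 (-1) 0 * fromBlocks a 0 0 d =
        fromBlocks 0 1 (-1) 0 ↔
      IsUnit a ∧ d = (aᵀ)⁻¹ := by
  have key : (fromBlocks a 0 0 d)ᵀ * fromBlocks 0 1 (-1) 0 * fromBlocks a 0 0 d =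
      fromBlocks 0 1 (-1) 0 ↔ aᵀ * d = 1 ∧ dᵀ * a = 1 := by
    simp [fromBlocks_transpose, fromBlocks_multiply, fromBlocks_inj]
  rw [key]
  constructor
  · rintro ⟨h, h'⟩
    exact ⟨IsUnit.of_mul_eq_one_right _ h', (inv_eq_right_inv h).symm⟩
  · rintro ⟨ha, rfl⟩
    have hdet : IsUnit a.det := (isUnit_iff_isUnit_det a).1 ha
    refine ⟨mul_nonsing_inv _ (by rwa [det_transpose]), ?_⟩
    rw [transpose_nonsing_inv, transpose_transpose, nonsing_inv_mul _ hdet]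

/-- A block matrix lies in `Sp(l,ℂ)` and commutes with `g_Θ = diag(i·I, −i·I)` iff it is
`fromBlocks a 0 0 (aᵀ)⁻¹` with `a` invertible; hence the centralizer of `g_Θ` in
`Sp(l,ℂ)` is `{fromBlocks a 0 0 (aᵀ)⁻¹ : a ∈ GL(l,ℂ)}` and coincides with the
centralizer of `H_Θ = (π/2)•g_Θ`. -/
theorem stmt9 (l : ℕ) (hl : 0 < l)
    (Ω gΘ : Matrix (Fin l ⊕ Fin l) (Fin l ⊕ Fin l) ℂ)
    (hΩ : Ω = fromBlocks 0 1 (-1) 0)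
    (hgΘ : gΘ = fromBlocks (Complex.I • 1) 0 0 ((-Complex.I) • 1)) :
    (∀ a b c d : Matrix (Fin l) (Fin l) ℂ,
      ((fromBlocks a b c d)ᵀ * Ω * fromBlocks a b c d = Ω ∧
        fromBlocks a b c d * gΘ = gΘ * fromBlocks a b c d)
      ↔ (b = 0 ∧ c = 0 ∧ IsUnit a ∧ d = (aᵀ)⁻¹)) ∧
    {M : Matrix (Fin l ⊕ Fin l) (Fin l ⊕ Fin l) ℂ | Mᵀ * Ω * M = Ω ∧ M * gΘ = gΘ * M}
      = {M | ∃ a : Matrix (Fin l) (Fin l) ℂ, IsUnit a ∧ M = fromBlocks a 0 0 (aᵀ)⁻¹} ∧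
    {M : Matrix (Fin l ⊕ Fin l) (Fin l ⊕ Fin l) ℂ | Mᵀ * Ω * M = Ω ∧ M * gΘ = gΘ * M}
      = {M | Mᵀ * Ω * M = Ω ∧
          M * (((Real.pi / 2 : ℝ) : ℂ) • gΘ) = (((Real.pi / 2 : ℝ) : ℂ) • gΘ) * M} := by
  subst hΩ hgΘ
  have blocks : ∀ a b c d : Matrix (Fin l) (Fin l) ℂ,
      ((fromBlocks a b c d)ᵀ * fromBlocks 0 1 (-1) 0 * fromBlocks a b c d =
          fromBlocks 0 1 (-1) 0 ∧
        fromBlocks a b c d * fromBlocks (Complex.I • 1) 0 0 ((-Complex.I) • 1) =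
          fromBlocks (Complex.I • 1) 0 0 ((-Complex.I) • 1) * fromBlocks a b c d)
      ↔ (b = 0 ∧ c = 0 ∧ IsUnit a ∧ d = (aᵀ)⁻¹) := by
    intro a b c d
    rw [fromBlocks_mul_diag_I_comm_iff]
    constructor
    · rintro ⟨h, rfl, rfl⟩
      exact ⟨rfl, rfl, (fromBlocks_diagonal_symplectic_iff a d).1 h⟩
    · rintro ⟨rfl, rfl, h⟩
      exact ⟨(fromBlocks_diagonal_symplectic_iff a d).2 h, rfl, rfl⟩
  refine ⟨blocks, ?_, ?_⟩
  · ext M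
    constructor
    · intro h
      rw [← fromBlocks_toBlocks M] at h ⊢
      obtain ⟨hb, hc, ha, hd⟩ := (blocks _ _ _ _).1 h
      exact ⟨_, ha, by rw [hb, hc, hd]⟩
    · rintro ⟨a, ha, rfl⟩
      exact (blocks _ _ _ _).2 ⟨rfl, rfl, ha, rfl⟩
  · have hpi : ((Real.pi / 2 : ℝ) : ℂ) ≠ 0 :=
      Complex.ofReal_ne_zero.2 (div_ne_zero Real.pi_ne_zero two_ne_zero)
    ext M
    simp only [Set.mem_ofPred_eq, Matrix.mul_smul, Matrix.smul_mul,
      (smul_right_injective _ hpi).eq_iff]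
end

section
/- Let l ≥ 1. The map a ↦ Matrix.fromBlocks a 0 0 ((aᵀ)⁻¹) is an injective group homomorphism from the unitary group U(l) into Matrix (2l) (2l) ℂ, whose image is exactly the set of elements of Sp(l,ℂ) ∩ U(2l) that commute with g_Θ = diag(iI_l, −iI_l). (In other words, the isotropy subgroup U_Θ = Z_{Sp(l,ℂ)}(g_Θ) ∩ Sp(l) is isomorphic to U(l).) -/
open Matrix

/-- For a unitary `a`, the inverse transpose of `a` is its entrywise conjugate. -/
theorem inv_transpose_of_conjTranspose_mul_self {n R : Type*} [Fintype n] [DecidableEq n]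
    [CommRing R] [StarRing R] {a : Matrix n n R} (ha : aᴴ * a = 1) : (aᵀ)⁻¹ = aᴴᵀ := by
  apply inv_eq_right_inv
  rw [← transpose_mul, ha, transpose_one]

/-- A block matrix commuting with `diag(i·I, −i·I)` has vanishing off-diagonal blocks. -/
theorem offDiag_eq_zero_of_commute {n : Type*} [Fintype n] [DecidableEq n]
    {A B C D : Matrix n n ℂ}
    (h : fromBlocks A B C D * fromBlocks (Complex.I • 1) 0 0 ((-Complex.I) • 1)
      = fromBlocks (Complex.I • 1) 0 0 ((-Complex.I) • 1) * fromBlocks A B C D) :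
    B = 0 ∧ C = 0 := by
  simp only [fromBlocks_multiply, fromBlocks_inj, Matrix.mul_smul, Matrix.smul_mul,
    Matrix.mul_one, Matrix.one_mul, Matrix.mul_zero, Matrix.zero_mul, add_zero, zero_add,
    neg_smul, Matrix.mul_neg, Matrix.neg_mul] at h
  have eq_zero {X : Matrix n n ℂ} (hX : Complex.I • X = -(Complex.I • X)) : X = 0 := by
    ext i j
    simpa [self_eq_neg] using congrFun₂ hX i j
  exact ⟨eq_zero h.2.1.symm, eq_zero h.2.2.1⟩

/-- The map `a ↦ fromBlocks a 0 0 (aᵀ)⁻¹` is an injective multiplicative map from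
`U(l)` into the `2l×2l` matrices whose image is exactly the set of elements of
`Sp(l,ℂ) ∩ U(2l)` commuting with `g_Θ = diag(i·I, −i·I)`. -/
theorem stmt10 (l : ℕ) (hl : 0 < l)
    (Ω gΘ : Matrix (Fin l ⊕ Fin l) (Fin l ⊕ Fin l) ℂ)
    (hΩ : Ω = fromBlocks 0 1 (-1) 0)
    (hgΘ : gΘ = fromBlocks (Complex.I • 1) 0 0 ((-Complex.I) • 1)) :
    (∀ a : Matrix (Fin l) (Fin l) ℂ, aᴴ * a = 1 → ∀ b : Matrix (Fin l) (Fin l) ℂ,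
      bᴴ * b = 1 →
      fromBlocks (a * b) 0 0 (((a * b)ᵀ)⁻¹)
        = fromBlocks a 0 0 ((aᵀ)⁻¹) * fromBlocks b 0 0 ((bᵀ)⁻¹)) ∧
    (∀ a : Matrix (Fin l) (Fin l) ℂ, aᴴ * a = 1 → ∀ b : Matrix (Fin l) (Fin l) ℂ,
      bᴴ * b = 1 →
      fromBlocks a 0 0 ((aᵀ)⁻¹) = fromBlocks b 0 0 ((bᵀ)⁻¹) → a = b) ∧
    {M : Matrix (Fin l ⊕ Fin l) (Fin l ⊕ Fin l) ℂ |
        ∃ a : Matrix (Fin l) (Fin l) ℂ, aᴴ * a = 1 ∧ M = fromBlocks a 0 0 ((aᵀ)⁻¹)}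
      = {M : Matrix (Fin l ⊕ Fin l) (Fin l ⊕ Fin l) ℂ |
          Mᵀ * Ω * M = Ω ∧ Mᴴ * M = 1 ∧ M * gΘ = gΘ * M} := by
  subst hΩ hgΘ
  refine ⟨fun a _ b _ => ?_, fun a _ b _ h => (fromBlocks_inj.mp h).1, ?_⟩
  · simp [fromBlocks_multiply, transpose_mul, Matrix.mul_inv_rev]
  ext M
  constructor
  · rintro ⟨a, ha, rfl⟩
    rw [inv_transpose_of_conjTranspose_mul_self ha]
    have hat : aᵀ * aᴴᵀ = 1 := by rw [← transpose_mul, ha, transpose_one]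
    have hd : aᴴᵀᴴ = aᵀ := by ext; simp
    refine ⟨?_, ?_, ?_⟩
    · simp [fromBlocks_transpose, fromBlocks_multiply, ha, hat]
    · simp [fromBlocks_conjTranspose, fromBlocks_multiply, ha, hat, hd]
    · simp [fromBlocks_multiply]
  · rintro ⟨hS, hU, hC⟩
    obtain ⟨A, B, C, D, rfl⟩ : ∃ A B C D, M = fromBlocks A B C D :=
      ⟨_, _, _, _, (fromBlocks_toBlocks M).symm⟩
    obtain ⟨rfl, rfl⟩ := offDiag_eq_zero_of_commute hC
    simp only [fromBlocks_transpose, fromBlocks_conjTranspose, fromBlocks_multiply,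
      ← fromBlocks_one, fromBlocks_inj, transpose_zero, conjTranspose_zero, Matrix.mul_zero,
      Matrix.zero_mul, Matrix.mul_one, add_zero, zero_add] at hS hU
    exact ⟨A, hU.1, by rw [inv_eq_right_inv hS.2.1]⟩
end

section
/- Let l ≥ 1. The Cayley transform Φ sending the matrix Matrix.fromBlocks A B (B.map star) (A.map star) ∈ sp(l)* (with A ∈ u(l), B symmetric complex) to the real matrix Matrix.fromBlocks (Re A + Re B) (Im B − Im A) (Im A + Im B) (Re A − Re B) is a bijection from sp(l)* onto sp(l,ℝ) that preserves Lie brackets: Φ(XY − YX) = Φ(X)Φ(Y) − Φ(Y)Φ(X) for all X, Y ∈ sp(l)*. Hence sp(l)* and sp(l,ℝ) are isomorphic as real Lie algebras. -/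
open Matrix

namespace CayleyTransform

variable {m n k : Type*}

lemma map_re_mul [Fintype n] (A : Matrix m n ℂ) (B : Matrix n k ℂ) :
    (A * B).map Complex.re =
      A.map Complex.re * B.map Complex.re - A.map Complex.im * B.map Complex.im := by
  ext i j
  simp [mul_apply, Finset.sum_sub_distrib]

lemma map_im_mul [Fintype n] (A : Matrix m n ℂ) (B : Matrix n k ℂ) :
    (A * B).map Complex.im =
      A.map Complex.re * B.map Complex.im + A.map Complex.im * B.map Complex.re := by
  ext i j
  simp [mul_apply, Finset.sum_add_distrib]

lemma map_re_add (A B : Matrix m k ℂ) :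
    (A + B).map Complex.re = A.map Complex.re + B.map Complex.re := by
  ext; simp

lemma map_im_add (A B : Matrix m k ℂ) :
    (A + B).map Complex.im = A.map Complex.im + B.map Complex.im := by
  ext; simp

lemma map_star_map_re (A : Matrix m k ℂ) :
    (A.map star).map Complex.re = A.map Complex.re := by
  ext; simp

lemma map_star_map_im (A : Matrix m k ℂ) :
    (A.map star).map Complex.im = -A.map Complex.im := by
  ext; simp

/-- The real form of a complex block matrix, built from its two upper blocks. It is the matrix of
`z ↦ A z + B (conj z)` in the coordinates `(Re z, Im z)`. -/
def cayley (M : Matrix (n ⊕ n) (n ⊕ n) ℂ) : Matrix (n ⊕ n) (n ⊕ n) ℝ :=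
  fromBlocks
    ((M.toBlocks₁₁).map Complex.re + (M.toBlocks₁₂).map Complex.re)
    ((M.toBlocks₁₂).map Complex.im - (M.toBlocks₁₁).map Complex.im)
    ((M.toBlocks₁₁).map Complex.im + (M.toBlocks₁₂).map Complex.im)
    ((M.toBlocks₁₁).map Complex.re - (M.toBlocks₁₂).map Complex.re)

lemma cayley_sub (M N : Matrix (n ⊕ n) (n ⊕ n) ℂ) : cayley (M - N) = cayley M - cayley N := by
  ext (i | i) (j | j) <;> simp [cayley, toBlocks₁₁, toBlocks₁₂] <;> ring

lemma cayley_mul [Fintype n] (A B C D : Matrix n n ℂ) :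
    cayley (fromBlocks A B (B.map star) (A.map star) *
        fromBlocks C D (D.map star) (C.map star)) =
      cayley (fromBlocks A B (B.map star) (A.map star)) *
        cayley (fromBlocks C D (D.map star) (C.map star)) := by
  simp only [cayley, fromBlocks_multiply, toBlocks_fromBlocks₁₁, toBlocks_fromBlocks₁₂,
    map_re_add, map_im_add, map_re_mul, map_im_mul, map_star_map_re, map_star_map_im]
  congr 1 <;> noncomm_ring

end CayleyTransform

/-- The Cayley transform `Φ`, sending `fromBlocks A B (conj B) (conj A) ∈ sp(l)*` to
`fromBlocks (Re A + Re B) (Im B − Im A) (Im A + Im B) (Re A − Re B)`, is a bijection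
from `sp(l)*` onto `sp(l,ℝ)` preserving commutator brackets: `sp(l)* ≅ sp(l,ℝ)` as
real Lie algebras. -/
theorem stmt12 (l : ℕ) (hl : 0 < l)
    (spstar : Set (Matrix (Fin l ⊕ Fin l) (Fin l ⊕ Fin l) ℂ))
    (hspstar : spstar = {M | ∃ (A B : Matrix (Fin l) (Fin l) ℂ),
      Aᴴ = -A ∧ Bᵀ = B ∧ M = fromBlocks A B (B.map star) (A.map star)})
    (spR : Set (Matrix (Fin l ⊕ Fin l) (Fin l ⊕ Fin l) ℝ))
    (hspR : spR = {M | ∃ (a b c : Matrix (Fin l) (Fin l) ℝ),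
      bᵀ = b ∧ cᵀ = c ∧ M = fromBlocks a b c (-aᵀ)})
    (Φ : Matrix (Fin l ⊕ Fin l) (Fin l ⊕ Fin l) ℂ →
      Matrix (Fin l ⊕ Fin l) (Fin l ⊕ Fin l) ℝ)
    (hΦ : Φ = fun M => fromBlocks
      ((M.toBlocks₁₁).map Complex.re + (M.toBlocks₁₂).map Complex.re)
      ((M.toBlocks₁₂).map Complex.im - (M.toBlocks₁₁).map Complex.im)
      ((M.toBlocks₁₁).map Complex.im + (M.toBlocks₁₂).map Complex.im)
      ((M.toBlocks₁₁).map Complex.re - (M.toBlocks₁₂).map Complex.re)) :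
    Set.BijOn Φ spstar spR ∧
    ∀ X ∈ spstar, ∀ Y ∈ spstar,
      Φ (X * Y - Y * X) = Φ X * Φ Y - Φ Y * Φ X := by
  have hΦ' : Φ = CayleyTransform.cayley := hΦ
  subst hspstar hspR
  refine ⟨⟨?_, ?_, ?_⟩, ?_⟩
  · rintro _ ⟨A, B, hA, hB, rfl⟩
    have hA' (i j) : star (A j i) = -A i j := congr_fun₂ hA i j
    have hB' (i j) : B j i = B i j := congr_fun₂ hB i j
    have hre (i j) : (A j i).re = -(A i j).re := by simpa using congr_arg Complex.re (hA' i j)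
    have him (i j) : (A j i).im = (A i j).im := by simpa using congr_arg Complex.im (hA' i j)
    refine ⟨A.map Complex.re + B.map Complex.re, B.map Complex.im - A.map Complex.im,
      A.map Complex.im + B.map Complex.im, ?_, ?_, ?_⟩
    · ext i j
      simp [him i j, hB' i j]
    · ext i j
      simp [him i j, hB' i j]
    · simp only [hΦ, toBlocks_fromBlocks₁₁, toBlocks_fromBlocks₁₂]
      congr 1
      ext i j
      simp [hre i j, hB' i j]
      ring
  · rintro _ ⟨A, B, -, -, rfl⟩ _ ⟨C, D, -, -, rfl⟩ h
    simp only [hΦ, toBlocks_fromBlocks₁₁, toBlocks_fromBlocks₁₂, fromBlocks_inj] at h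
    obtain ⟨h₁₁, h₁₂, h₂₁, h₂₂⟩ := h
    have entries (i j) : A i j = C i j ∧ B i j = D i j := by
      have e₁₁ := congr_fun₂ h₁₁ i j
      have e₁₂ := congr_fun₂ h₁₂ i j
      have e₂₁ := congr_fun₂ h₂₁ i j
      have e₂₂ := congr_fun₂ h₂₂ i j
      simp only [Matrix.add_apply, Matrix.sub_apply, map_apply] at e₁₁ e₁₂ e₂₁ e₂₂
      constructor <;> apply Complex.ext <;> linarith
    obtain rfl : A = C := by ext i j; exact (entries i j).1
    obtain rfl : B = D := by ext i j; exact (entries i j).2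
    rfl
  · rintro _ ⟨a, b, c, hb, hc, rfl⟩
    have hb' (i j) : b j i = b i j := congr_fun₂ hb i j
    have hc' (i j) : c j i = c i j := congr_fun₂ hc i j
    refine ⟨_, ⟨of fun i j => ⟨(a i j - a j i) / 2, (c i j - b i j) / 2⟩,
      of fun i j => ⟨(a i j + a j i) / 2, (b i j + c i j) / 2⟩, ?_, ?_, rfl⟩, ?_⟩
    · ext i j
      apply Complex.ext
      · simp
        ring
      · simp [hb' i j, hc' i j]
    · ext i j
      simp [hb' i j, hc' i j, add_comm (a j i)]
    · simp only [hΦ, toBlocks_fromBlocks₁₁, toBlocks_fromBlocks₁₂]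
      congr 1 <;> ext i j <;> simp <;> ring
  · rintro _ ⟨A, B, -, -, rfl⟩ _ ⟨C, D, -, -, rfl⟩
    rw [hΦ', CayleyTransform.cayley_sub, CayleyTransform.cayley_mul,
      CayleyTransform.cayley_mul]
end

section
/- Let l ≥ 1. The map u ↦ Matrix.fromBlocks (Re u) (−Im u) (Im u) (Re u) is an injective group homomorphism from the unitary group U(l) into Matrix (2l) (2l) ℝ, whose image is exactly the centralizer of J = fromBlocks 0 1 (−1) 0 in SO(2l), i.e. {g ∈ SO(2l) : g * J = J * g}. (Since H_Θ = (π/2)•J, this identifies the isotropy group U_Θ = {g ∈ SO(2l) : g * H_Θ = H_Θ * g} with U(l).) -/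
open Matrix

/-- The real `2 × 2` block matrix of a complex matrix. -/
def realBlocks {n : Type*} (u : Matrix n n ℂ) : Matrix (n ⊕ n) (n ⊕ n) ℝ :=
  fromBlocks (u.map Complex.re) (-(u.map Complex.im)) (u.map Complex.im) (u.map Complex.re)

namespace realBlocks

variable {n : Type*}

theorem injective : Function.Injective (realBlocks (n := n)) := by
  intro u v h
  obtain ⟨hre, -, him, -⟩ := fromBlocks_inj.mp h
  ext i j
  exact Complex.ext (congrFun₂ hre i j) (congrFun₂ him i j)

theorem conjTranspose (u : Matrix n n ℂ) : realBlocks uᴴ = (realBlocks u)ᵀ := by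
  rw [realBlocks, realBlocks, fromBlocks_transpose, fromBlocks_inj]
  refine ⟨?_, ?_, ?_, ?_⟩ <;> ext i j <;> simp

theorem one [DecidableEq n] : realBlocks (1 : Matrix n n ℂ) = 1 := by
  rw [realBlocks, ← fromBlocks_one, fromBlocks_inj]
  refine ⟨?_, ?_, ?_, ?_⟩ <;> ext i j <;> by_cases h : i = j <;>
    simp [Matrix.one_apply, h]

theorem mul [Fintype n] (u v : Matrix n n ℂ) :
    realBlocks (u * v) = realBlocks u * realBlocks v := by
  simp only [realBlocks, fromBlocks_multiply, fromBlocks_inj]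
  refine ⟨?_, ?_, ?_, ?_⟩ <;> ext i j <;>
    simp [Matrix.mul_apply, Finset.sum_add_distrib, Finset.sum_sub_distrib] <;> ring

theorem transpose_mul_self_eq_one_iff [Fintype n] [DecidableEq n] (u : Matrix n n ℂ) :
    (realBlocks u)ᵀ * realBlocks u = 1 ↔ uᴴ * u = 1 := by
  rw [← conjTranspose, ← mul, ← one, injective.eq_iff]

/-- The determinant of the realification is the squared modulus of the complex determinant. -/
theorem det [Fintype n] [DecidableEq n] (u : Matrix n n ℂ) :
    (realBlocks u).det = Complex.normSq u.det := by
  let Q : Matrix (n ⊕ n) (n ⊕ n) ℂ := fromBlocks 1 0 (Complex.I • 1) 1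
  have hQ : Q.det = 1 := by simp [Q]
  have h : (realBlocks u).map Complex.ofRealHom * Q =
      Q * fromBlocks (u.map (starRingEnd ℂ)) ((-(u.map Complex.im)).map Complex.ofRealHom) 0 u := by
    simp only [realBlocks, Q, fromBlocks_map, fromBlocks_multiply, fromBlocks_inj]
    refine ⟨?_, ?_, ?_, ?_⟩ <;> ext i j <;> simp [Complex.ext_iff]
  have hd := congrArg Matrix.det h
  rw [det_mul, det_mul, hQ, det_fromBlocks_zero₂₁, mul_one, one_mul] at hd
  have hre : ((realBlocks u).map Complex.ofRealHom).det = ((realBlocks u).det : ℂ) :=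
    (Complex.ofRealHom.map_det (realBlocks u)).symm
  have hconj : (u.map (starRingEnd ℂ)).det = starRingEnd ℂ u.det :=
    ((starRingEnd ℂ).map_det u).symm
  rw [hre, hconj, ← Complex.normSq_eq_conj_mul_self] at hd
  exact_mod_cast hd

theorem det_eq_one [Fintype n] [DecidableEq n] {u : Matrix n n ℂ} (hu : uᴴ * u = 1) :
    (realBlocks u).det = 1 := by
  have h := congrArg Matrix.det hu
  rw [det_mul, det_conjTranspose, det_one] at h
  rw [det]
  have hnorm : (Complex.normSq u.det : ℂ) = 1 := by
    rw [Complex.normSq_eq_conj_mul_self]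
    exact h
  exact_mod_cast hnorm

/-- The real matrices commuting with the standard complex structure are the realifications. -/
theorem commute_iff [Fintype n] [DecidableEq n] (g : Matrix (n ⊕ n) (n ⊕ n) ℝ) :
    g * fromBlocks 0 1 (-1) 0 = fromBlocks 0 1 (-1) 0 * g ↔
      ∃ u : Matrix n n ℂ, g = realBlocks u := by
  constructor
  · intro h
    rw [← fromBlocks_toBlocks g] at h ⊢
    simp only [fromBlocks_multiply, fromBlocks_inj, Matrix.mul_zero, Matrix.zero_mul,
      Matrix.mul_one, Matrix.one_mul, Matrix.mul_neg, Matrix.neg_mul, zero_add, add_zero] at h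
    obtain ⟨h₁, h₂, -, -⟩ := h
    refine ⟨of fun i j => ⟨g.toBlocks₁₁ i j, g.toBlocks₂₁ i j⟩, fromBlocks_inj.mpr
      ⟨rfl, ?_, rfl, h₂.symm⟩⟩
    rw [← neg_eq_iff_eq_neg, h₁]
    rfl
  · rintro ⟨u, rfl⟩
    simp [realBlocks, fromBlocks_multiply]

end realBlocks

/-- The map `u ↦ fromBlocks (Re u) (−Im u) (Im u) (Re u)` is an injective multiplicative
map from `U(l)` into `Matrix (2l) (2l) ℝ` whose image is exactly the centralizer of
`J = fromBlocks 0 1 (−1) 0` in `SO(2l)`; since `H_Θ = (π/2)•J`, this identifies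
`U_Θ = {g ∈ SO(2l) : g H_Θ = H_Θ g}` with `U(l)`. -/
theorem stmt15 (l : ℕ) (hl : 0 < l)
    (J : Matrix (Fin l ⊕ Fin l) (Fin l ⊕ Fin l) ℝ)
    (hJ : J = fromBlocks 0 1 (-1) 0) :
    (∀ u : Matrix (Fin l) (Fin l) ℂ, uᴴ * u = 1 → ∀ v : Matrix (Fin l) (Fin l) ℂ,
      vᴴ * v = 1 →
      fromBlocks ((u * v).map Complex.re) (-((u * v).map Complex.im))
          ((u * v).map Complex.im) ((u * v).map Complex.re)
        = fromBlocks (u.map Complex.re) (-(u.map Complex.im))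
            (u.map Complex.im) (u.map Complex.re) *
          fromBlocks (v.map Complex.re) (-(v.map Complex.im))
            (v.map Complex.im) (v.map Complex.re)) ∧
    (∀ u v : Matrix (Fin l) (Fin l) ℂ,
      fromBlocks (u.map Complex.re) (-(u.map Complex.im))
          (u.map Complex.im) (u.map Complex.re)
        = fromBlocks (v.map Complex.re) (-(v.map Complex.im))
            (v.map Complex.im) (v.map Complex.re) → u = v) ∧
    {M : Matrix (Fin l ⊕ Fin l) (Fin l ⊕ Fin l) ℝ |
        ∃ u : Matrix (Fin l) (Fin l) ℂ, uᴴ * u = 1 ∧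
          M = fromBlocks (u.map Complex.re) (-(u.map Complex.im))
              (u.map Complex.im) (u.map Complex.re)}
      = {g | gᵀ * g = 1 ∧ g.det = 1 ∧ g * J = J * g} ∧
    {g : Matrix (Fin l ⊕ Fin l) (Fin l ⊕ Fin l) ℝ |
        gᵀ * g = 1 ∧ g.det = 1 ∧ g * J = J * g}
      = {g | gᵀ * g = 1 ∧ g.det = 1 ∧
          g * ((Real.pi / 2) • J) = ((Real.pi / 2) • J) * g} := by
  subst hJ
  refine ⟨fun u _ v _ => realBlocks.mul u v, fun u v h => realBlocks.injective h, ?_, ?_⟩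
  · ext g
    constructor
    · rintro ⟨u, hu, rfl⟩
      exact ⟨(realBlocks.transpose_mul_self_eq_one_iff u).mpr hu, realBlocks.det_eq_one hu,
        (realBlocks.commute_iff _).mpr ⟨u, rfl⟩⟩
    · rintro ⟨hg, -, hc⟩
      obtain ⟨u, rfl⟩ := (realBlocks.commute_iff g).mp hc
      exact ⟨u, (realBlocks.transpose_mul_self_eq_one_iff u).mp hg, rfl⟩
  · ext g
    have hpi : Real.pi / 2 ≠ 0 := by positivity
    simp only [Set.mem_ofPred_eq, Matrix.mul_smul, Matrix.smul_mul, smul_right_inj hpi]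
end

section
/- Let l ≥ 1. For every Y ∈ Matrix l l ℂ with Yᵀ = −Y, the matrix M(Y) := Matrix.fromBlocks (−(i/2)•Y) ((π/2)•1 + (1/2)•Y) (−(π/2)•1 + (1/2)•Y) ((i/2)•Y) belongs to so*(2l) if and only if Y = 0; moreover M(0) = H_Θ (viewed as a complex matrix). In other words, the fiber H_Θ + n_Θ⁺ (transported by the isomorphism f to the standard realization) meets so*(2l) exactly in {H_Θ}. -/
open Matrix

/-- For skew-symmetric `Y`, the matrix
`M(Y) = fromBlocks (−(i/2)•Y) ((π/2)•1 + (1/2)•Y) (−(π/2)•1 + (1/2)•Y) ((i/2)•Y)`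
belongs to `so*(2l)` iff `Y = 0`, and `M(0) = H_Θ`; hence the fiber `H_Θ + n_Θ⁺`
meets `so*(2l)` exactly in `{H_Θ}`. -/
theorem stmt16 (l : ℕ) (hl : 0 < l)
    (HΘ : Matrix (Fin l ⊕ Fin l) (Fin l ⊕ Fin l) ℂ)
    (hHΘ : HΘ = (((Real.pi / 2 : ℝ)) : ℂ) • fromBlocks 0 1 (-1) 0)
    (sostar : Set (Matrix (Fin l ⊕ Fin l) (Fin l ⊕ Fin l) ℂ))
    (hsostar : sostar = {M | ∃ (Z₁ Z₂ : Matrix (Fin l) (Fin l) ℂ),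
      Z₁ᵀ = -Z₁ ∧ Z₂ᴴ = Z₂ ∧ M = fromBlocks Z₁ Z₂ (-(Z₂.map star)) (Z₁.map star)})
    (M : Matrix (Fin l) (Fin l) ℂ → Matrix (Fin l ⊕ Fin l) (Fin l ⊕ Fin l) ℂ)
    (hM : M = fun Y => fromBlocks
      ((-(Complex.I / 2)) • Y)
      (((Real.pi : ℂ) / 2) • 1 + (1 / 2 : ℂ) • Y)
      (-(((Real.pi : ℂ) / 2) • (1 : Matrix (Fin l) (Fin l) ℂ)) + (1 / 2 : ℂ) • Y)
      ((Complex.I / 2) • Y)) :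
    (∀ Y : Matrix (Fin l) (Fin l) ℂ, Yᵀ = -Y → (M Y ∈ sostar ↔ Y = 0)) ∧
    M 0 = HΘ := by
  subst hHΘ hsostar hM
  have conj_two : starRingEnd ℂ 2 = 2 := map_ofNat _ 2
  have zero_case : (fromBlocks
      ((-(Complex.I / 2)) • (0 : Matrix (Fin l) (Fin l) ℂ))
      (((Real.pi : ℂ) / 2) • 1 + (1 / 2 : ℂ) • (0 : Matrix (Fin l) (Fin l) ℂ))
      (-(((Real.pi : ℂ) / 2) • (1 : Matrix (Fin l) (Fin l) ℂ)) + (1 / 2 : ℂ) • 0)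
      ((Complex.I / 2) • 0)) = (((Real.pi / 2 : ℝ)) : ℂ) • fromBlocks 0 1 (-1) 0 := by
    simp [fromBlocks_smul]
  refine ⟨fun Y _ => ⟨?_, ?_⟩, zero_case⟩
  · rintro ⟨Z₁, Z₂, -, -, h⟩
    obtain ⟨rfl, rfl, h₂₁, h₂₂⟩ := fromBlocks_inj.mp h
    ext i j
    have hreal : star (Y i j) = Y i j := by
      have := congrFun₂ h₂₂ i j
      have hI : Complex.I / 2 ≠ 0 := by simp
      apply mul_left_cancel₀ hI
      simpa [conj_two, neg_div] using this.symm
    have himag : star (Y i j) = -Y i j := by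
      have := congrFun₂ h₂₁ i j
      by_cases hij : i = j <;>
      · simp [conj_two, hij] at this ⊢
        linear_combination 2 * this
    rw [Matrix.zero_apply]
    linear_combination (himag - hreal) / 2
  · rintro rfl
    refine ⟨0, ((Real.pi : ℂ) / 2) • 1, by simp, by simp [conjTranspose_smul], ?_⟩
    simp only [zero_case, fromBlocks_smul]
    congr 1
    · simp
    · simp
    · ext i j
      by_cases hij : i = j <;> simp [conj_two, hij]
    · ext; simp
end

section
/- Let A = !![0,1;1,0], B = !![1,0;0,−1], C = !![0,1;−1,0] in Matrix 2 2 ℝ. The adjoint orbit of B under SL(2,ℝ) is the one-sheeted hyperboloid: {g * B * g⁻¹ : g ∈ SL(2,ℝ)} = {x•A + y•B + z•C : x, y, z ∈ ℝ, x² + y² − z² = 1}. -/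
open Matrix

/-- Conjugating `!![1, 0; 0, -1]` by an element of `SL(2,ℝ)`, entry by entry. -/
theorem conj_diag_one_neg_one {g : SpecialLinearGroup (Fin 2) ℝ} {a b c d : ℝ}
    (h : (g : Matrix (Fin 2) (Fin 2) ℝ) = !![a, b; c, d]) :
    (g : Matrix (Fin 2) (Fin 2) ℝ) * !![1, 0; 0, -1] *
        ((g⁻¹ : SpecialLinearGroup (Fin 2) ℝ) : Matrix (Fin 2) (Fin 2) ℝ)
      = !![a * d + b * c, -2 * (a * b); 2 * (c * d), -(a * d + b * c)] := by
  rw [Matrix.SpecialLinearGroup.coe_inv, h, adjugate_fin_two_of]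
  ext i j
  fin_cases i <;> fin_cases j <;> simp [Matrix.mul_apply, Fin.sum_univ_two] <;> ring

/-- Every point of `y² + p q = 1` has the form of the entries of a conjugate of
`!![1, 0; 0, -1]` by an element of `SL(2,ℝ)`. -/
theorem exists_det_one_of_sq_add_mul_eq_one {y p q : ℝ} (h : y ^ 2 + p * q = 1) :
    ∃ a b c d : ℝ, a * d - b * c = 1 ∧ a * d + b * c = y ∧ -2 * (a * b) = p ∧
      2 * (c * d) = q := by
  by_cases hy : 1 + y = 0
  · obtain rfl : y = -1 := by linarith
    exact ⟨p, -1 / 2, 2, q / 4, by linarith, by linarith, by ring, by ring⟩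
  · refine ⟨1 + y, -p / (2 * (1 + y)), q, 1 / 2, ?_, ?_, ?_, ?_⟩
    · field_simp
      linarith
    · field_simp
      linarith
    · field_simp
    · ring

/-- The adjoint orbit of `B = !![1,0;0,−1]` under `SL(2,ℝ)` is the one-sheeted
hyperboloid `{x•A + y•B + z•C : x² + y² − z² = 1}`. -/
theorem stmt17 (A B C : Matrix (Fin 2) (Fin 2) ℝ)
    (hA : A = !![0, 1; 1, 0]) (hB : B = !![1, 0; 0, -1]) (hC : C = !![0, 1; -1, 0]) :
    {M : Matrix (Fin 2) (Fin 2) ℝ | ∃ g : Matrix.SpecialLinearGroup (Fin 2) ℝ,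
        M = (g : Matrix (Fin 2) (Fin 2) ℝ) * B * ((g⁻¹ : Matrix.SpecialLinearGroup (Fin 2) ℝ) : Matrix (Fin 2) (Fin 2) ℝ)}
      = {M : Matrix (Fin 2) (Fin 2) ℝ | ∃ x y z : ℝ,
          x ^ 2 + y ^ 2 - z ^ 2 = 1 ∧ M = x • A + y • B + z • C} := by
  subst hA hB hC
  ext M
  have hsum (x y z : ℝ) : x • !![0, 1; 1, 0] + y • !![1, 0; 0, -1] + z • !![0, 1; -1, 0]
      = !![y, x + z; x - z, -y] := by
    ext i j
    fin_cases i <;> fin_cases j <;> simp [sub_eq_add_neg]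
  simp only [Set.mem_ofPred_eq, hsum]
  constructor
  · rintro ⟨g, rfl⟩
    obtain ⟨a, b, c, d, hg⟩ : ∃ a b c d, (g : Matrix (Fin 2) (Fin 2) ℝ) = !![a, b; c, d] :=
      ⟨_, _, _, _, eta_fin_two _⟩
    have hdet := g.det_coe
    rw [hg, det_fin_two_of] at hdet
    refine ⟨c * d - a * b, a * d + b * c, -(a * b) - c * d, ?_, ?_⟩
    · linear_combination (a * d - b * c + 1) * hdet
    · rw [conj_diag_one_neg_one hg]
      congr! 3 <;> ring_nf
  · rintro ⟨x, y, z, h, rfl⟩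
    obtain ⟨a, b, c, d, hdet, hy, hp, hq⟩ :=
      exists_det_one_of_sq_add_mul_eq_one (y := y) (p := x + z) (q := x - z)
        (by linear_combination h)
    have hg : (!![a, b; c, d]).det = 1 := by rwa [det_fin_two_of]
    refine ⟨⟨_, hg⟩, Eq.trans ?_ (conj_diag_one_neg_one rfl).symm⟩
    rw [hy, hp, hq]
end
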